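/- Self-normalized empirical variance bound: with H²•P̂^a_t = (μ/(μ−ψ(μ))) Σ_{s≤t} H_s² 1{X_s=a} + b²α/(μ−ψ(μ)) for μ ∈ (0,3) with μ > ψ(μ) = e^μ − μ − 1, one has for any ε > 0 and v > w > 0: P(H•M^a_t ≥ √(2(1+ε)α H²•P̂^a_t) + αb/3, w ≤ H²•P̂^a_t ≤ v) ≤ 2⌈log(v/w+1)/log(1+ε)⌉ e^{−α} P(⟨H•M^a⟩_t > 0). -/

import Mathlib

open MeasureTheory Finset

lemma hasSum_exp_sub_sub_one (x : ℝ) :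
    HasSum (fun k : ℕ => x ^ (k + 2) / ((k + 2).factorial : ℝ)) (Real.exp x - x - 1) := by
  have h := NormedSpace.expSeries_div_hasSum_exp (𝔸 := ℝ) x
  rw [← congrFun Real.exp_eq_exp_ℝ x] at h
  have h2 := (hasSum_nat_add_iff' 2).mpr h
  have e : Real.exp x - ∑ i ∈ range 2, x ^ i / (i.factorial : ℝ) = Real.exp x - x - 1 := by
    simp [Finset.sum_range_succ]
    ring
  exact e ▸ h2

lemma exp_sub_sub_one_le_of_abs_le {x c : ℝ} (hc : 0 < c) (hx : |x| ≤ c) :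
    Real.exp x - x - 1 ≤ (Real.exp c - c - 1) / c ^ 2 * x ^ 2 := by
  refine hasSum_le (fun k => ?_) (hasSum_exp_sub_sub_one x)
    (((hasSum_exp_sub_sub_one c).div_const (c ^ 2)).mul_right (x ^ 2))
  have h1 : x ^ k ≤ c ^ k :=
    (le_abs_self _).trans (by rw [abs_pow]; exact pow_le_pow_left₀ (abs_nonneg x) hx k)
  have h2 : c ^ (k + 2) / ((k + 2).factorial : ℝ) / c ^ 2 * x ^ 2
      = c ^ k * x ^ 2 / ((k + 2).factorial : ℝ) := by
    field_simp
    ring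
  rw [h2, pow_add]
  gcongr

lemma exp_sub_sub_one_le_div {c : ℝ} (hc : 0 < c) (hc3 : c < 3) :
    Real.exp c - c - 1 ≤ c ^ 2 / (2 * (1 - c / 3)) := by
  have hg := (hasSum_geometric_of_lt_one (r := c / 3) (by positivity)
    (by linarith)).mul_left (c ^ 2 / 2)
  have e : c ^ 2 / (2 * (1 - c / 3)) = c ^ 2 / 2 * (1 - c / 3)⁻¹ := by
    rw [← div_div, div_eq_mul_inv (c ^ 2 / 2)]
  rw [e]
  refine hasSum_le (fun k => ?_) (hasSum_exp_sub_sub_one c) hg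
  have h1 : (2 * 3 ^ k : ℝ) ≤ ((k + 2).factorial : ℝ) := by
    have := Nat.factorial_mul_pow_le_factorial (m := 2) (n := k)
    rw [add_comm k 2]
    exact_mod_cast this
  calc c ^ (k + 2) / ((k + 2).factorial : ℝ) ≤ c ^ (k + 2) / (2 * 3 ^ k) := by gcongr
    _ = c ^ 2 / 2 * (c / 3) ^ k := by rw [div_pow, pow_add]; field_simp

lemma bernoulli_mgf_le {q K c : ℝ} (hq0 : 0 ≤ q) (hq1 : q ≤ 1) (hc : 0 < c) (hK : |K| ≤ c) :
    q * Real.exp (K * (1 - q)) + (1 - q) * Real.exp (-(K * q))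
      ≤ Real.exp ((Real.exp c - c - 1) / c ^ 2 * (K ^ 2 * q * (1 - q))) := by
  have h1 := exp_sub_sub_one_le_of_abs_le (x := K * (1 - q)) hc (by
    rw [abs_mul, abs_of_nonneg (sub_nonneg.2 hq1)]
    exact (mul_le_of_le_one_right (abs_nonneg K) (by linarith)).trans hK)
  have h2 := exp_sub_sub_one_le_of_abs_le (x := -(K * q)) hc (by
    rw [abs_neg, abs_mul, abs_of_nonneg hq0]
    exact (mul_le_of_le_one_right (abs_nonneg K) hq1).trans hK)
  have h3 := Real.add_one_le_exp ((Real.exp c - c - 1) / c ^ 2 * (K ^ 2 * q * (1 - q)))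
  have h4 := mul_le_mul_of_nonneg_left h1 hq0
  have h5 := mul_le_mul_of_nonneg_left h2 (sub_nonneg.2 hq1)
  linarith

lemma subgamma_exponent {α v b : ℝ} (hα : 0 < α) (hv : 0 < v) (hb : 0 < b) :
    ∃ l : ℝ, 0 < l ∧ ∀ x y : ℝ, √(2 * α * v) + α * b / 3 ≤ x → 0 ≤ y → y ≤ v →
      α ≤ l * x - (Real.exp (l * b) - l * b - 1) / (l * b) ^ 2 * (l ^ 2 * y) := by
  set u := √(2 * α * v) / v with hu
  have hr : 0 < √(2 * α * v) := Real.sqrt_pos.2 (by positivity)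
  have hu0 : 0 < u := by positivity
  have hr2 : √(2 * α * v) = u * v := by rw [hu]; field_simp
  have huv : u ^ 2 * v = 2 * α := by
    have := Real.sq_sqrt (show 0 ≤ 2 * α * v by positivity)
    rw [hr2] at this
    have h : v * (u ^ 2 * v) = v * (2 * α) := by linarith
    exact mul_left_cancel₀ hv.ne' h
  have hD : 0 < 1 + b / 3 * u := by positivity
  refine ⟨u / (1 + b / 3 * u), by positivity, fun x y hx hy hyv => ?_⟩
  set l := u / (1 + b / 3 * u) with hl
  have hl0 : 0 < l := by positivity
  have hlD : l * (1 + b / 3 * u) = u := by rw [hl]; field_simp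
  have h1 : 1 - l * b / 3 = 1 / (1 + b / 3 * u) := by rw [hl]; field_simp; ring
  have hpos : 0 < 1 - l * b / 3 := by rw [h1]; positivity
  have hψ := exp_sub_sub_one_le_div (c := l * b) (by positivity) (by linarith)
  have h2 : (Real.exp (l * b) - l * b - 1) / (l * b) ^ 2 * (l ^ 2 * y)
      ≤ l ^ 2 * v * (1 + b / 3 * u) / 2 := by
    have : (Real.exp (l * b) - l * b - 1) / (l * b) ^ 2 ≤ (1 + b / 3 * u) / 2 := by
      rw [div_le_iff₀ (by positivity)]
      refine hψ.trans (le_of_eq ?_)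
      rw [h1]; field_simp
    calc _ ≤ (1 + b / 3 * u) / 2 * (l ^ 2 * v) := by gcongr
      _ = _ := by ring
  have h3 : l * (√(2 * α * v) + α * b / 3) ≤ l * x := by gcongr
  have h4 : l * (√(2 * α * v) + α * b / 3) - l ^ 2 * v * (1 + b / 3 * u) / 2 = α := by
    rw [hr2]
    have e1 : l ^ 2 * v * (1 + b / 3 * u) = l * (u * v) := by
      calc _ = l * v * (l * (1 + b / 3 * u)) := by ring
        _ = _ := by rw [hlD]; ring
    rw [e1]
    have e2 : (l * (u * v + α * b / 3) - l * (u * v) / 2) * (1 + b / 3 * u)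
        = α * (1 + b / 3 * u) := by
      calc _ = (l * (1 + b / 3 * u)) * (u * v / 2 + α * b / 3) := by ring
        _ = u ^ 2 * v / 2 + α * b / 3 * u := by rw [hlD]; ring
        _ = _ := by rw [huv]; ring
    exact mul_right_cancel₀ hD.ne' e2
  linarith

section Freedman

variable {Ω : Type*} {m0 : MeasurableSpace Ω} {μ : Measure Ω} [IsProbabilityMeasure μ]

lemma integral_mul_eq_of_condExp_eq {m : MeasurableSpace Ω} (hm : m ≤ m0) {f I q : Ω → ℝ}
    (hf : StronglyMeasurable[m] f) (hI : Integrable I μ) (hfI : Integrable (f * I) μ)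
    (h : μ[I | m] =ᵐ[μ] q) :
    ∫ ω, f ω * I ω ∂μ = ∫ ω, f ω * q ω ∂μ := by
  have h1 := condExp_mul_of_stronglyMeasurable_left hf hfI hI
  have h2 := integral_condExp (μ := μ) (f := f * I) hm
  rw [show (∫ ω, f ω * I ω ∂μ) = ∫ ω, (f * I) ω ∂μ from rfl, ← h2]
  refine integral_congr_ae ?_
  filter_upwards [h1, h] with ω e1 e2
  rw [e1, Pi.mul_apply, e2]

lemma ae_eq_zero_of_condExp_eq_zero {m : MeasurableSpace Ω} (hm : m ≤ m0) {I q : Ω → ℝ}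
    (hI : Integrable I μ) (hI0 : ∀ ω, 0 ≤ I ω) (hq : StronglyMeasurable[m] q)
    (h : μ[I | m] =ᵐ[μ] q) :
    ∀ᵐ ω ∂μ, q ω = 0 → I ω = 0 := by
  have hS : MeasurableSet[m] {ω | q ω = 0} := hq.measurable (measurableSet_singleton 0)
  have hf : StronglyMeasurable[m] ({ω | q ω = 0}.indicator (fun _ => (1 : ℝ))) :=
    stronglyMeasurable_const.indicator hS
  have hfe : {ω | q ω = 0}.indicator (fun _ => (1 : ℝ)) * I = {ω | q ω = 0}.indicator I := by
    ext ω
    by_cases hω : q ω = 0 <;> simp [Set.indicator, hω]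
  have hfI : Integrable ({ω | q ω = 0}.indicator (fun _ => (1 : ℝ)) * I) μ := by
    rw [hfe]
    exact hI.indicator (hm _ hS)
  have key := integral_mul_eq_of_condExp_eq hm hf hI hfI h
  have hz : ∫ ω, {ω | q ω = 0}.indicator (fun _ => (1 : ℝ)) ω * q ω ∂μ = 0 := by
    rw [← integral_zero Ω ℝ]
    refine integral_congr_ae (Filter.Eventually.of_forall fun ω => ?_)
    by_cases hω : q ω = 0 <;> simp [Set.indicator, hω]
  rw [hz] at key
  have h0 := (integral_eq_zero_iff_of_nonneg (fun ω => ?_) hfI).1 key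
  · filter_upwards [h0] with ω hω hqω
    simpa [Set.indicator, hqω] using hω
  · simp only [Pi.mul_apply, Pi.zero_apply]
    exact mul_nonneg (Set.indicator_nonneg (fun _ _ => zero_le_one) ω) (hI0 ω)

lemma integrable_of_stronglyMeasurable_of_abs_le {m : MeasurableSpace Ω} (hm : m ≤ m0)
    {f : Ω → ℝ} (hf : StronglyMeasurable[m] f) {C : ℝ} (hC : ∀ ω, |f ω| ≤ C) :
    Integrable f μ :=
  Integrable.of_bound (hf.mono hm).aestronglyMeasurable C (Filter.Eventually.of_forall hC)

lemma integral_mul_exp_bernoulli_le {m : MeasurableSpace Ω} (hm : m ≤ m0) {W K I q : Ω → ℝ}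
    {c C : ℝ} (hc : 0 < c) (hW : StronglyMeasurable[m] W) (hW0 : ∀ ω, 0 ≤ W ω)
    (hWC : ∀ ω, W ω ≤ C) (hK : StronglyMeasurable[m] K) (hKc : ∀ ω, |K ω| ≤ c)
    (hq : StronglyMeasurable[m] q) (hq01 : ∀ ω, 0 ≤ q ω ∧ q ω ≤ 1)
    (hI : Integrable I μ) (hI01 : ∀ ω, I ω = 0 ∨ I ω = 1) (h : μ[I | m] =ᵐ[μ] q) :
    ∫ ω, W ω * Real.exp (K ω * (I ω - q ω) -
        (Real.exp c - c - 1) / c ^ 2 * (K ω ^ 2 * q ω * (1 - q ω))) ∂μ ≤ ∫ ω, W ω ∂μ := by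
  set g := (Real.exp c - c - 1) / c ^ 2 with hg
  have hg0 : 0 ≤ g := by
    have := Real.add_one_le_exp c
    exact div_nonneg (by linarith) (by positivity)
  set R : Ω → ℝ := fun ω => W ω * Real.exp (-(g * (K ω ^ 2 * q ω * (1 - q ω)))) with hR
  set P : Ω → ℝ := fun ω => R ω * Real.exp (K ω * (1 - q ω)) with hP
  set N : Ω → ℝ := fun ω => R ω * Real.exp (-(K ω * q ω)) with hN
  have hRm : StronglyMeasurable[m] R :=
    hW.mul (Real.continuous_exp.comp_stronglyMeasurable
      ((((hK.pow 2).mul hq).mul (stronglyMeasurable_const.sub hq)).const_mul g).neg)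
  have hPm : StronglyMeasurable[m] P :=
    hRm.mul (Real.continuous_exp.comp_stronglyMeasurable
      (hK.mul (stronglyMeasurable_const.sub hq)))
  have hNm : StronglyMeasurable[m] N :=
    hRm.mul (Real.continuous_exp.comp_stronglyMeasurable (hK.mul hq).neg)
  have hR0 : ∀ ω, 0 ≤ R ω := fun ω => mul_nonneg (hW0 ω) (Real.exp_pos _).le
  have hRC : ∀ ω, R ω ≤ C := fun ω => by
    refine (mul_le_of_le_one_right (hW0 ω) (Real.exp_le_one_iff.2 ?_)).trans (hWC ω)
    have := sub_nonneg.2 (hq01 ω).2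
    have := (hq01 ω).1
    rw [neg_nonpos]
    positivity
  have bound : ∀ ω x, |x| ≤ c → |R ω * Real.exp x| ≤ C * Real.exp c := fun ω x hx => by
    rw [abs_of_nonneg (mul_nonneg (hR0 ω) (Real.exp_pos _).le)]
    exact mul_le_mul (hRC ω) (Real.exp_le_exp.2 ((le_abs_self x).trans hx)) (Real.exp_pos _).le
      ((hR0 ω).trans (hRC ω))
  have hPb : ∀ ω, |P ω| ≤ C * Real.exp c := fun ω => bound ω _ (by
    rw [abs_mul, abs_of_nonneg (sub_nonneg.2 (hq01 ω).2)]
    exact (mul_le_of_le_one_right (abs_nonneg _) (by linarith [(hq01 ω).1])).trans (hKc ω))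
  have hNb : ∀ ω, |N ω| ≤ C * Real.exp c := fun ω => bound ω _ (by
    rw [abs_neg, abs_mul, abs_of_nonneg (hq01 ω).1]
    exact (mul_le_of_le_one_right (abs_nonneg _) (hq01 ω).2).trans (hKc ω))
  have hPi : Integrable P μ := integrable_of_stronglyMeasurable_of_abs_le hm hPm hPb
  have hNi : Integrable N μ := integrable_of_stronglyMeasurable_of_abs_le hm hNm hNb
  have hWi : Integrable W μ := integrable_of_stronglyMeasurable_of_abs_le hm hW
    (fun ω => (abs_of_nonneg (hW0 ω)).trans_le (hWC ω))
  have hsub : StronglyMeasurable[m] (P - N) := hPm.sub hNm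
  have hsubb : ∀ ω, ‖(P - N) ω‖ ≤ 2 * (C * Real.exp c) := fun ω => by
    have := abs_sub (P ω) (N ω)
    have h1 := hPb ω
    have h2 := hNb ω
    simp only [Pi.sub_apply, Real.norm_eq_abs]
    linarith
  have hsI : Integrable ((P - N) * I) μ := hI.bdd_mul (hsub.mono hm).aestronglyMeasurable
    (Filter.Eventually.of_forall hsubb)
  have hsq : Integrable ((P - N) * q) μ :=
    (integrable_of_stronglyMeasurable_of_abs_le hm hq (C := 1) (fun ω => by
      rw [abs_of_nonneg (hq01 ω).1]; exact (hq01 ω).2)).bdd_mul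
      (hsub.mono hm).aestronglyMeasurable (Filter.Eventually.of_forall hsubb)
  have key := integral_mul_eq_of_condExp_eq hm hsub hI hsI h
  calc ∫ ω, W ω * Real.exp (K ω * (I ω - q ω) - g * (K ω ^ 2 * q ω * (1 - q ω))) ∂μ
      = ∫ ω, ((P - N) ω * I ω + N ω) ∂μ := by
        refine integral_congr_ae (Filter.Eventually.of_forall fun ω => ?_)
        simp only [Pi.sub_apply, hP, hN, hR]
        rcases hI01 ω with h0 | h0
        · rw [h0, mul_zero, zero_add, mul_assoc (W ω), ← Real.exp_add]
          congr 2; ring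
        · rw [h0, mul_one, sub_add_cancel, mul_assoc (W ω), ← Real.exp_add]
          congr 2; ring
    _ = ∫ ω, ((P - N) ω * q ω + N ω) ∂μ := by
        exact (integral_add hsI hNi).trans ((congrArg (· + _) key).trans
          (integral_add hsq hNi).symm)
    _ ≤ ∫ ω, W ω ∂μ := by
        refine integral_mono (hsq.add hNi) hWi fun ω => ?_
        have hb := bernoulli_mgf_le (hq01 ω).1 (hq01 ω).2 hc (hKc ω)
        calc (P - N) ω * q ω + N ω
            = R ω * (q ω * Real.exp (K ω * (1 - q ω)) + (1 - q ω) * Real.exp (-(K ω * q ω))) := by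
              simp only [Pi.sub_apply, hP, hN]; ring
          _ ≤ R ω * Real.exp (g * (K ω ^ 2 * q ω * (1 - q ω))) :=
              mul_le_mul_of_nonneg_left hb (hR0 ω)
          _ = W ω := by
              simp only [hR]
              rw [mul_assoc, ← Real.exp_add, neg_add_cancel, Real.exp_zero, mul_one]

variable {ℱ : Filtration ℕ m0} {K I q : ℕ → Ω → ℝ} {c : ℝ}

lemma freedman_measure_le (hc : 0 < c)
    (hK : ∀ s, StronglyMeasurable[ℱ (s - 1)] (K s)) (hKc : ∀ s ω, |K s ω| ≤ c)
    (hq : ∀ s, StronglyMeasurable[ℱ (s - 1)] (q s)) (hq01 : ∀ s ω, 0 ≤ q s ω ∧ q s ω ≤ 1)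
    (hI : ∀ s, StronglyMeasurable[ℱ s] (I s)) (hI01 : ∀ s ω, I s ω = 0 ∨ I s ω = 1)
    (h : ∀ s, μ[I s | ℱ (s - 1)] =ᵐ[μ] q s) {α : ℝ} (hα : 0 < α) (n : ℕ) :
    μ {ω | α ≤ ∑ s ∈ range n, K s ω * (I s ω - q s ω) -
        (Real.exp c - c - 1) / c ^ 2 * ∑ s ∈ range n, K s ω ^ 2 * q s ω * (1 - q s ω)}
      ≤ ENNReal.ofReal (Real.exp (-α)) *
        μ {ω | 0 < ∑ s ∈ range n, K s ω ^ 2 * q s ω * (1 - q s ω)} := by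
  set g := (Real.exp c - c - 1) / c ^ 2 with hg
  have hg0 : 0 ≤ g := by
    have := Real.add_one_le_exp c
    exact div_nonneg (by linarith) (by positivity)
  set Y : ℕ → Ω → ℝ := fun s ω =>
    K s ω * (I s ω - q s ω) - g * (K s ω ^ 2 * q s ω * (1 - q s ω)) with hY
  have hnn : ∀ s ω, 0 ≤ K s ω ^ 2 * q s ω * (1 - q s ω) := fun s ω =>
    mul_nonneg (mul_nonneg (sq_nonneg _) (hq01 s ω).1) (sub_nonneg.2 (hq01 s ω).2)
  have hsm : ∀ s, s - 1 ≤ s := fun s => Nat.sub_le s 1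
  have hVm : ∀ s, StronglyMeasurable[ℱ (s - 1)] (fun ω => K s ω ^ 2 * q s ω * (1 - q s ω)) :=
    fun s => (((hK s).pow 2).mul (hq s)).mul (stronglyMeasurable_const.sub (hq s))
  have hYm : ∀ s, StronglyMeasurable[ℱ s] (Y s) := fun s =>
    (((hK s).mono (ℱ.mono (hsm s))).mul ((hI s).sub ((hq s).mono (ℱ.mono (hsm s))))).sub
      (((hVm s).mono (ℱ.mono (hsm s))).const_mul g)
  have hYc : ∀ s ω, Y s ω ≤ c := fun s ω => by
    have h1 : |K s ω * (I s ω - q s ω)| ≤ c := by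
      rw [abs_mul]
      refine (mul_le_of_le_one_right (abs_nonneg _) (abs_le.2 ?_)).trans (hKc s ω)
      have := hq01 s ω
      rcases hI01 s ω with h0 | h0 <;> rw [h0] <;> constructor <;> linarith
    have := (le_abs_self _).trans h1
    have := mul_nonneg hg0 (hnn s ω)
    simp only [hY]
    linarith
  set W : ℕ → Ω → ℝ := fun n ω => Real.exp (∑ s ∈ range n, Y s ω) with hW
  have hWm : ∀ n, StronglyMeasurable[ℱ (n - 1)] (W n) := fun n =>
    Real.continuous_exp.comp_stronglyMeasurable
      (Finset.stronglyMeasurable_fun_sum _ fun s hs =>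
        (hYm s).mono (ℱ.mono (by have := Finset.mem_range.1 hs; omega)))
  have hWC : ∀ n ω, W n ω ≤ Real.exp (n * c) := fun n ω => by
    refine Real.exp_le_exp.2 ((Finset.sum_le_sum fun s _ => hYc s ω).trans ?_)
    simp
  have hIint : ∀ s, Integrable (I s) μ := fun s =>
    integrable_of_stronglyMeasurable_of_abs_le (ℱ.le s) (hI s) (C := 1) fun ω => by
      rcases hI01 s ω with h0 | h0 <;> simp [h0]
  have hWi : ∀ n, Integrable (W n) μ := fun n =>
    integrable_of_stronglyMeasurable_of_abs_le (ℱ.le _) (hWm n)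
      fun ω => (abs_of_nonneg (Real.exp_pos _).le).trans_le (hWC n ω)
  have hE : ∀ n, ∫ ω, W n ω ∂μ ≤ 1 := by
    intro n
    induction n with
    | zero => simp [hW]
    | succ n ih =>
      refine le_trans ?_ ih
      have := integral_mul_exp_bernoulli_le (ℱ.le (n - 1)) hc (hWm n)
        (fun ω => (Real.exp_pos _).le) (hWC n) (hK n) (hKc n) (hq n) (hq01 n) (hIint n)
        (hI01 n) (h n)
      refine le_trans (le_of_eq (integral_congr_ae (Filter.Eventually.of_forall fun ω => ?_))) this
      simp only [hW, Finset.sum_range_succ, Real.exp_add]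
      rfl
  have hWeq : ∀ ω, ∑ s ∈ range n, Y s ω = ∑ s ∈ range n, K s ω * (I s ω - q s ω) -
      g * ∑ s ∈ range n, K s ω ^ 2 * q s ω * (1 - q s ω) := fun ω => by
    simp only [hY, Finset.sum_sub_distrib, Finset.mul_sum]
  set G : Set Ω := {ω | 0 < ∑ s ∈ range n, K s ω ^ 2 * q s ω * (1 - q s ω)} with hG
  have hGm : MeasurableSet G := measurableSet_lt measurable_const
    (Finset.measurable_fun_sum _ fun s _ => ((hVm s).mono (ℱ.le _)).measurable)
  have hnull : ∀ᵐ ω ∂μ, ω ∉ G → W n ω = 1 := by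
    have h0 : ∀ᵐ ω ∂μ, ∀ s, q s ω = 0 → I s ω = 0 := ae_all_iff.2 fun s =>
      ae_eq_zero_of_condExp_eq_zero (ℱ.le _) (hIint s)
        (fun ω => by rcases hI01 s ω with h0 | h0 <;> simp [h0]) (hq s) (h s)
    have h1 : ∀ᵐ ω ∂μ, ∀ s, 1 - q s ω = 0 → 1 - I s ω = 0 := ae_all_iff.2 fun s =>
      ae_eq_zero_of_condExp_eq_zero (ℱ.le (s - 1)) (I := fun ω => 1 - I s ω)
        (q := fun ω => 1 - q s ω) ((integrable_const 1).sub (hIint s))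
        (fun ω => by rcases hI01 s ω with h0 | h0 <;> simp [h0])
        (stronglyMeasurable_const.sub (hq s)) (by
          have e := condExp_sub (m := ℱ (s - 1)) (integrable_const (μ := μ) (1 : ℝ)) (hIint s)
          refine Filter.EventuallyEq.trans e ?_
          filter_upwards [h s] with ω hω
          rw [Pi.sub_apply, hω, condExp_const (ℱ.le _)])
    filter_upwards [h0, h1] with ω h0 h1 hω
    have hz := (Finset.sum_eq_zero_iff_of_nonneg (fun s _ => hnn s ω)).1
      (le_antisymm (not_lt.1 hω) (Finset.sum_nonneg fun s _ => hnn s ω))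
    simp only [hW]
    rw [Finset.sum_eq_zero, Real.exp_zero]
    intro s hs
    have hzs := hz s hs
    simp only [hY, hzs, mul_zero, sub_zero]
    rcases mul_eq_zero.1 hzs with h2 | h2
    · rcases mul_eq_zero.1 h2 with h3 | h3
      · rw [pow_eq_zero_iff two_ne_zero |>.1 h3, zero_mul]
      · rw [h0 s h3, h3, sub_zero, mul_zero]
    · have := h1 s h2
      rw [show I s ω - q s ω = 0 by linarith, mul_zero]
  have hGint : ∫ ω in G, W n ω ∂μ ≤ μ.real G := by
    have e1 := integral_add_compl hGm (hWi n)
    have e2 : ∫ ω in Gᶜ, W n ω ∂μ = μ.real Gᶜ := by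
      rw [setIntegral_congr_ae (g := fun _ => (1 : ℝ)) hGm.compl (by
        filter_upwards [hnull] with ω hω h using hω h)]
      simp
    have e3 := probReal_add_probReal_compl (μ := μ) hGm
    have e4 := hE n
    linarith
  have hsub : {ω | α ≤ ∑ s ∈ range n, Y s ω} ≤ᵐ[μ] (G ∩ {ω | Real.exp α ≤ W n ω} : Set Ω) := by
    filter_upwards [hnull] with ω hω hle
    have hle' : α ≤ ∑ s ∈ range n, Y s ω := hle
    have hW' : Real.exp α ≤ W n ω := Real.exp_le_exp.2 hle'
    refine ⟨?_, hW'⟩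
    by_contra hn
    have h1 := hω hn
    have h2 := Real.one_lt_exp_iff.2 hα
    linarith
  have hmarkov : Real.exp α * (μ.restrict G).real {ω | Real.exp α ≤ W n ω}
      ≤ ∫ ω in G, W n ω ∂μ :=
    mul_meas_ge_le_integral_of_nonneg
      (Filter.Eventually.of_forall fun ω => (Real.exp_pos _).le) (hWi n).restrict _
  have hWset : MeasurableSet {ω | Real.exp α ≤ W n ω} :=
    measurableSet_le measurable_const ((hWm n).mono (ℱ.le _)).measurable
  simp only [← hWeq]
  refine (measure_mono_ae hsub).trans ?_
  rw [measureReal_restrict_apply hWset, Set.inter_comm] at hmarkov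
  rw [← ofReal_measureReal (s := G), ← ENNReal.ofReal_mul (Real.exp_pos _).le,
    ← ofReal_measureReal]
  refine ENNReal.ofReal_le_ofReal ?_
  rw [Real.exp_neg, inv_mul_eq_div, le_div_iff₀ (Real.exp_pos α), mul_comm]
  exact hmarkov.trans hGint

lemma bernstein_measure_le {b : ℝ} {H : ℕ → Ω → ℝ} (hb : 0 < b)
    (hH : ∀ s, StronglyMeasurable[ℱ (s - 1)] (H s)) (hHb : ∀ s ω, |H s ω| ≤ b)
    (hq : ∀ s, StronglyMeasurable[ℱ (s - 1)] (q s)) (hq01 : ∀ s ω, 0 ≤ q s ω ∧ q s ω ≤ 1)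
    (hI : ∀ s, StronglyMeasurable[ℱ s] (I s)) (hI01 : ∀ s ω, I s ω = 0 ∨ I s ω = 1)
    (h : ∀ s, μ[I s | ℱ (s - 1)] =ᵐ[μ] q s) {α v : ℝ} (hα : 0 < α) (hv : 0 < v) (n : ℕ) :
    μ {ω | √(2 * α * v) + α * b / 3 ≤ ∑ s ∈ range n, H s ω * (I s ω - q s ω) ∧
        ∑ s ∈ range n, H s ω ^ 2 * q s ω * (1 - q s ω) ≤ v}
      ≤ ENNReal.ofReal (Real.exp (-α)) *
        μ {ω | 0 < ∑ s ∈ range n, H s ω ^ 2 * q s ω * (1 - q s ω)} := by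
  obtain ⟨l, hl, hlx⟩ := subgamma_exponent hα hv hb
  have key := freedman_measure_le (μ := μ) (ℱ := ℱ) (K := fun s ω => l * H s ω) (c := l * b)
    (by positivity) (fun s => (hH s).const_mul l)
    (fun s ω => by rw [abs_mul, abs_of_pos hl]; exact mul_le_mul_of_nonneg_left (hHb s ω) hl.le)
    hq hq01 hI hI01 h hα n
  have e1 : ∀ ω, ∑ s ∈ range n, l * H s ω * (I s ω - q s ω)
      = l * ∑ s ∈ range n, H s ω * (I s ω - q s ω) := fun ω => by
    simp only [Finset.mul_sum, mul_assoc]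
  have e2 : ∀ ω, ∑ s ∈ range n, (l * H s ω) ^ 2 * q s ω * (1 - q s ω)
      = l ^ 2 * ∑ s ∈ range n, H s ω ^ 2 * q s ω * (1 - q s ω) := fun ω => by
    simp only [Finset.mul_sum, mul_assoc, mul_pow]
  simp only [e1, e2] at key
  refine (measure_mono fun ω hω => ?_).trans (key.trans ?_)
  · exact hlx _ _ hω.1 (Finset.sum_nonneg fun s _ => mul_nonneg
      (mul_nonneg (sq_nonneg _) (hq01 s ω).1) (sub_nonneg.2 (hq01 s ω).2)) hω.2
  · refine mul_le_mul' le_rfl (measure_mono fun ω hω => ?_)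
    exact pos_of_mul_pos_right hω (sq_nonneg l)

lemma measure_empirical_variance_lt_le {b : ℝ} {H : ℕ → Ω → ℝ} (hb : 0 < b)
    (hH : ∀ s, StronglyMeasurable[ℱ (s - 1)] (H s)) (hHb : ∀ s ω, |H s ω| ≤ b)
    (hq : ∀ s, StronglyMeasurable[ℱ (s - 1)] (q s)) (hq01 : ∀ s ω, 0 ≤ q s ω ∧ q s ω ≤ 1)
    (hI : ∀ s, StronglyMeasurable[ℱ s] (I s)) (hI01 : ∀ s ω, I s ω = 0 ∨ I s ω = 1)
    (h : ∀ s, μ[I s | ℱ (s - 1)] =ᵐ[μ] q s) {α c : ℝ} (hα : 0 < α) (hc : 0 < c)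
    (hcψ : Real.exp c - c - 1 < c) (n : ℕ) :
    μ {ω | c / (c - (Real.exp c - c - 1)) * ∑ s ∈ range n, H s ω ^ 2 * I s ω +
          b ^ 2 * α / (c - (Real.exp c - c - 1)) < ∑ s ∈ range n, H s ω ^ 2 * q s ω}
      ≤ ENNReal.ofReal (Real.exp (-α)) *
        μ {ω | 0 < ∑ s ∈ range n, H s ω ^ 2 * q s ω * (1 - q s ω)} := by
  have hH2 : ∀ s ω, H s ω ^ 2 ≤ b ^ 2 := fun s ω => sq_le_sq.2 ((hHb s ω).trans (le_abs_self b))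
  have key := freedman_measure_le (μ := μ) (ℱ := ℱ) (K := fun s ω => -(c / b ^ 2) * H s ω ^ 2)
    (c := c) hc (fun s => ((hH s).pow 2).const_mul _)
    (fun s ω => by
      rw [abs_mul, abs_neg, abs_of_pos (by positivity), abs_of_nonneg (sq_nonneg _),
        div_mul_eq_mul_div, div_le_iff₀ (by positivity)]
      exact mul_le_mul_of_nonneg_left (hH2 s ω) hc.le)
    hq hq01 hI hI01 h hα n
  have hVV : ∀ ω, ∑ s ∈ range n, (-(c / b ^ 2) * H s ω ^ 2) ^ 2 * q s ω * (1 - q s ω)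
      ≤ c ^ 2 / b ^ 2 * ∑ s ∈ range n, H s ω ^ 2 * q s ω * (1 - q s ω) := fun ω => by
    rw [Finset.mul_sum]
    refine Finset.sum_le_sum fun s _ => ?_
    have h0 : 0 ≤ c ^ 2 / b ^ 2 * (H s ω ^ 2 * q s ω * (1 - q s ω)) := mul_nonneg (by positivity)
      (mul_nonneg (mul_nonneg (sq_nonneg _) (hq01 s ω).1) (sub_nonneg.2 (hq01 s ω).2))
    have h1 : H s ω ^ 2 / b ^ 2 ≤ 1 := div_le_one_of_le₀ (hH2 s ω) (sq_nonneg b)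
    calc _ = c ^ 2 / b ^ 2 * (H s ω ^ 2 * q s ω * (1 - q s ω)) * (H s ω ^ 2 / b ^ 2) := by
          field_simp
      _ ≤ _ := mul_le_of_le_one_right h0 h1
  have hVq : ∀ ω, ∑ s ∈ range n, H s ω ^ 2 * q s ω * (1 - q s ω)
      ≤ ∑ s ∈ range n, H s ω ^ 2 * q s ω := fun ω =>
    Finset.sum_le_sum fun s _ => mul_le_of_le_one_right
      (mul_nonneg (sq_nonneg _) (hq01 s ω).1) (by linarith [(hq01 s ω).1])
  refine (measure_mono fun ω hω => ?_).trans (key.trans ?_)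
  · have hψ0 : 0 ≤ Real.exp c - c - 1 := by linarith [Real.add_one_le_exp c]
    have hD : 0 < c - (Real.exp c - c - 1) := sub_pos.2 hcψ
    have hω' := Set.mem_ofPred_eq ▸ hω
    rw [div_mul_eq_mul_div, ← add_div, div_lt_iff₀ hD] at hω'
    have e1 : ∑ s ∈ range n, -(c / b ^ 2) * H s ω ^ 2 * (I s ω - q s ω)
        = c / b ^ 2 * (∑ s ∈ range n, H s ω ^ 2 * q s ω - ∑ s ∈ range n, H s ω ^ 2 * I s ω) := by
      rw [← Finset.sum_sub_distrib, Finset.mul_sum]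
      exact Finset.sum_congr rfl fun s _ => by ring
    have h2 : (Real.exp c - c - 1) / c ^ 2 *
        ∑ s ∈ range n, (-(c / b ^ 2) * H s ω ^ 2) ^ 2 * q s ω * (1 - q s ω)
        ≤ (Real.exp c - c - 1) / b ^ 2 * ∑ s ∈ range n, H s ω ^ 2 * q s ω := by
      calc _ ≤ (Real.exp c - c - 1) / c ^ 2 *
            (c ^ 2 / b ^ 2 * ∑ s ∈ range n, H s ω ^ 2 * q s ω) := by
            refine mul_le_mul_of_nonneg_left ((hVV ω).trans ?_) (by positivity)
            exact mul_le_mul_of_nonneg_left (hVq ω) (by positivity)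
        _ = _ := by field_simp
    simp only [Set.mem_ofPred_eq]
    rw [e1]
    refine le_trans ?_ (sub_le_sub_left h2 _)
    rw [div_mul_eq_mul_div, div_mul_eq_mul_div, ← sub_div, le_div_iff₀ (by positivity)]
    linarith
  · refine mul_le_mul' le_rfl (measure_mono fun ω hω => ?_)
    exact pos_of_mul_pos_right (lt_of_lt_of_le hω (hVV ω)) (by positivity)

end Freedman

lemma exists_geometric_slice {ε v w x : ℝ} (hε : 0 < ε) (hw : 0 < w) (hwx : w ≤ x) (hxv : x ≤ v) :
    ∃ k < ⌈Real.log (v / w + 1) / Real.log (1 + ε)⌉₊,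
      w * (1 + ε) ^ k ≤ x ∧ x ≤ w * (1 + ε) ^ (k + 1) := by
  obtain ⟨k, hk1, hk2⟩ := exists_nat_pow_near ((one_le_div hw).2 hwx) (by linarith : 1 < 1 + ε)
  refine ⟨k, Nat.lt_ceil.2 ?_, ?_, ?_⟩
  · rw [lt_div_iff₀ (Real.log_pos (by linarith)), ← Real.log_pow]
    refine Real.log_lt_log (by positivity) ?_
    have : x / w ≤ v / w := by gcongr
    linarith
  · rwa [le_div_iff₀ hw, mul_comm] at hk1
  · rw [div_lt_iff₀ hw, mul_comm] at hk2
    exact hk2.le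

lemma stronglyMeasurable_comp_of_indicator {Ω A ι : Type*} {m : MeasurableSpace Ω} [Finite A]
    [DecidableEq A] [Finite ι] (Y : ι → Ω → A) (f : (ι → A) → ℝ)
    (hY : ∀ i c, StronglyMeasurable[m] (fun ω => if Y i ω = c then (1 : ℝ) else 0)) :
    StronglyMeasurable[m] (fun ω => f (fun i => Y i ω)) := by
  let _ : MeasurableSpace A := ⊤
  have hYm : ∀ i, Measurable (Y i) := fun i => measurable_to_countable' fun c => by
    have h := (hY i c).measurable (measurableSet_singleton 1)
    convert h using 1
    ext ω
    simp
  exact ((Measurable.of_discrete (f := f)).comp (measurable_pi_lambda _ hYm)).stronglyMeasurable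

/- Self-normalized empirical variance bound: with
`H²•P̂^a_t = (μ₀/(μ₀−ψ(μ₀))) ∑_{s≤t} H_s² 1{X_s=a} + b²α/(μ₀−ψ(μ₀))` for
`μ₀ ∈ (0,3)` with `μ₀ > ψ(μ₀) = e^{μ₀} − μ₀ − 1`, one has for any `ε > 0` and
`v > w > 0`:
`P(H•M^a_t ≥ √(2(1+ε)α H²•P̂^a_t) + αb/3, w ≤ H²•P̂^a_t ≤ v)
  ≤ 2⌈log(v/w+1)/log(1+ε)⌉ e^{−α} P(⟨H•M^a⟩_t > 0)`. -/
theorem stmt16 {Ω : Type*} {m0 : MeasurableSpace Ω} (μ : Measure Ω)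
    [IsProbabilityMeasure μ] (ℱ : Filtration ℕ m0)
    {A : Type*} [Fintype A] [DecidableEq A]
    (d : ℕ) (X : ℕ → Ω → A)
    (hX : ∀ t a, StronglyMeasurable[ℱ t] (fun ω => (if X t ω = a then (1 : ℝ) else 0)))
    (p : A → (Fin d → A) → ℝ)
    (hp01 : ∀ a x, 0 ≤ p a x ∧ p a x ≤ 1)
    (hpsum : ∀ x, ∑ a, p a x = 1)
    (hMarkov : ∀ s, d ≤ s → ∀ a,
      μ[fun ω => (if X s ω = a then (1 : ℝ) else 0) | ℱ (s - 1)]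
        =ᵐ[μ] fun ω => p a (fun i => X (s - d + i) ω))
    (b : ℝ) (hb : 0 < b) (H : ℕ → Ω → ℝ)
    (hHmeas : ∀ s, StronglyMeasurable[ℱ (s - 1)] (H s))
    (hHbdd : ∀ s ω, |H s ω| ≤ b)
    (hH0 : ∀ s ≤ d, ∀ ω, H s ω = 0)
    (a : A)
    (M : ℕ → Ω → ℝ)
    (hM : ∀ t ω, M t ω = ∑ s ∈ Finset.range (t + 1),
      H s ω * ((if X s ω = a then (1 : ℝ) else 0) - p a (fun i => X (s - d + i) ω)))
    (QV : ℕ → Ω → ℝ)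
    (hQV : ∀ t ω, QV t ω = ∑ s ∈ Finset.range (t + 1),
      H s ω ^ 2 * p a (fun i => X (s - d + i) ω) * (1 - p a (fun i => X (s - d + i) ω)))
    (μ₀ : ℝ) (hμ₀ : 0 < μ₀) (hμ₀3 : μ₀ < 3)
    (hμ₀ψ : Real.exp μ₀ - μ₀ - 1 < μ₀)
    (α : ℝ) (hα : 0 < α)
    -- the empirical (inflated) variance process `H²•P̂^a`
    (EP : ℕ → Ω → ℝ)
    (hEP : ∀ t ω, EP t ω =
      (μ₀ / (μ₀ - (Real.exp μ₀ - μ₀ - 1))) *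
        ∑ s ∈ Finset.range (t + 1), H s ω ^ 2 * (if X s ω = a then (1 : ℝ) else 0) +
      b ^ 2 * α / (μ₀ - (Real.exp μ₀ - μ₀ - 1)))
    (ε v w : ℝ) (hε : 0 < ε) (hw : 0 < w) (hvw : w < v) (t : ℕ) :
    μ {ω | Real.sqrt (2 * (1 + ε) * α * EP t ω) + α * b / 3 ≤ M t ω ∧
          w ≤ EP t ω ∧ EP t ω ≤ v}
      ≤ ENNReal.ofReal
          (2 * ((⌈Real.log (v / w + 1) / Real.log (1 + ε)⌉ : ℤ) : ℝ) * Real.exp (-α)) *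
        μ {ω | 0 < QV t ω} := by
  classical
  set D := μ₀ - (Real.exp μ₀ - μ₀ - 1) with hD
  have hD0 : 0 < D := sub_pos.2 hμ₀ψ
  set I : ℕ → Ω → ℝ := fun s ω => if s ≤ d then 0 else if X s ω = a then 1 else 0 with hIdef
  set q : ℕ → Ω → ℝ := fun s ω => if s ≤ d then 0 else p a (fun i => X (s - d + i) ω) with hqdef
  have hI01 : ∀ s ω, I s ω = 0 ∨ I s ω = 1 := fun s ω => by
    simp only [hIdef]; split_ifs <;> simp
  have hq01 : ∀ s ω, 0 ≤ q s ω ∧ q s ω ≤ 1 := fun s ω => by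
    simp only [hqdef]; split_ifs
    · simp
    · exact hp01 _ _
  have hIm : ∀ s, StronglyMeasurable[ℱ s] (I s) := fun s => by
    by_cases hs : s ≤ d
    · simp only [hIdef, hs, if_true]; exact stronglyMeasurable_const
    · simp only [hIdef, hs, if_false]; exact hX s a
  have hqm : ∀ s, StronglyMeasurable[ℱ (s - 1)] (q s) := fun s => by
    by_cases hs : s ≤ d
    · simp only [hqdef, hs, if_true]; exact stronglyMeasurable_const
    · simp only [hqdef, hs, if_false]
      exact stronglyMeasurable_comp_of_indicator (fun i : Fin d => X (s - d + i)) (p a)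
        fun i c => (hX _ c).mono (ℱ.mono (by omega))
  have hcond : ∀ s, μ[I s | ℱ (s - 1)] =ᵐ[μ] q s := fun s => by
    by_cases hs : s ≤ d
    · simp only [hIdef, hqdef, hs, if_true]
      rw [condExp_const (ℱ.le _)]
    · simp only [hIdef, hqdef, hs, if_false]
      exact hMarkov s (not_le.1 hs).le a
  have hM' : ∀ ω, M t ω = ∑ s ∈ range (t + 1), H s ω * (I s ω - q s ω) := fun ω => by
    rw [hM]
    refine Finset.sum_congr rfl fun s _ => ?_
    by_cases hs : s ≤ d
    · simp [hH0 s hs]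
    · simp [hIdef, hqdef, hs]
  have hQV' : ∀ ω, QV t ω = ∑ s ∈ range (t + 1), H s ω ^ 2 * q s ω * (1 - q s ω) := fun ω => by
    rw [hQV]
    refine Finset.sum_congr rfl fun s _ => ?_
    by_cases hs : s ≤ d
    · simp [hH0 s hs]
    · simp [hqdef, hs]
  have hEP' : ∀ ω, EP t ω = μ₀ / D * ∑ s ∈ range (t + 1), H s ω ^ 2 * I s ω + b ^ 2 * α / D :=
    fun ω => by
    rw [hEP]
    congr 2
    refine Finset.sum_congr rfl fun s _ => ?_
    by_cases hs : s ≤ d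
    · simp [hH0 s hs]
    · simp [hIdef, hs]
  have hQVle : ∀ ω, QV t ω ≤ ∑ s ∈ range (t + 1), H s ω ^ 2 * q s ω := fun ω => by
    rw [hQV']
    exact Finset.sum_le_sum fun s _ => mul_le_of_le_one_right
      (mul_nonneg (sq_nonneg _) (hq01 s ω).1) (by linarith [(hq01 s ω).1])
  have hvar := measure_empirical_variance_lt_le (μ := μ) (ℱ := ℱ) hb hHmeas hHbdd hqm hq01 hIm
    hI01 hcond hα hμ₀ hμ₀ψ (t + 1)
  have hslice := fun k : ℕ => bernstein_measure_le (μ := μ) (ℱ := ℱ) hb hHmeas hHbdd hqm hq01 hIm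
    hI01 hcond hα (v := w * (1 + ε) ^ (k + 1)) (by positivity) (t + 1)
  rw [← hD] at hvar
  simp only [← hM', ← hQV', ← hEP'] at hvar hslice
  set L := Real.log (v / w + 1) / Real.log (1 + ε) with hL
  have hL0 : 0 < L := by
    have h1 : 0 < v / w := by have := hw.trans hvw; positivity
    exact div_pos (Real.log_pos (by linarith)) (Real.log_pos (by linarith))
  set n := ⌈L⌉₊ with hn
  have hn1 : 1 ≤ n := Nat.one_le_iff_ne_zero.2 (Nat.ceil_pos.2 hL0).ne'
  have hcast : ((⌈L⌉ : ℤ) : ℝ) = n := by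
    rw [hn, ← Int.natCast_ceil_eq_ceil hL0.le, Int.cast_natCast]
  have hcover : {ω | √(2 * (1 + ε) * α * EP t ω) + α * b / 3 ≤ M t ω ∧ w ≤ EP t ω ∧ EP t ω ≤ v}
      ⊆ {ω | EP t ω < ∑ s ∈ range (t + 1), H s ω ^ 2 * q s ω} ∪
        ⋃ k ∈ range n, {ω | √(2 * α * (w * (1 + ε) ^ (k + 1))) + α * b / 3 ≤ M t ω ∧
          QV t ω ≤ w * (1 + ε) ^ (k + 1)} := by
    rintro ω ⟨h1, h2, h3⟩
    rcases lt_or_ge (EP t ω) (∑ s ∈ range (t + 1), H s ω ^ 2 * q s ω) with h4 | h4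
    · exact Or.inl h4
    · obtain ⟨k, hk, hk1, hk2⟩ := exists_geometric_slice hε hw h2 h3
      refine Or.inr (Set.mem_biUnion (Finset.mem_coe.2 (Finset.mem_range.2 hk)) ⟨?_, ?_⟩)
      · refine le_trans (add_le_add_left (Real.sqrt_le_sqrt ?_) _) h1
        calc 2 * α * (w * (1 + ε) ^ (k + 1)) = 2 * (1 + ε) * α * (w * (1 + ε) ^ k) := by ring
          _ ≤ _ := by gcongr
      · exact (hQVle ω).trans (h4.trans hk2)
  have hcoef : (1 + n : ENNReal) * ENNReal.ofReal (Real.exp (-α))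
      ≤ ENNReal.ofReal (2 * (n : ℝ) * Real.exp (-α)) := by
    rw [ENNReal.ofReal_mul (by positivity), ENNReal.ofReal_mul (by positivity),
      ENNReal.ofReal_natCast, ENNReal.ofReal_ofNat, two_mul]
    gcongr
    exact_mod_cast hn1
  rw [hcast]
  calc _ ≤ _ := measure_mono hcover
    _ ≤ _ := measure_union_le _ _
    _ ≤ ENNReal.ofReal (Real.exp (-α)) * μ {ω | 0 < QV t ω} +
        ∑ k ∈ range n, ENNReal.ofReal (Real.exp (-α)) * μ {ω | 0 < QV t ω} :=
      add_le_add hvar ((measure_biUnion_finset_le _ _).trans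
        (Finset.sum_le_sum fun k _ => hslice k))
    _ = (1 + n : ENNReal) * ENNReal.ofReal (Real.exp (-α)) * μ {ω | 0 < QV t ω} := by
      rw [Finset.sum_const, Finset.card_range, nsmul_eq_mul]; ring
    _ ≤ _ := by gcongr
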